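/- For all n, k ∈ ℕ, the language S_{n·k} = { b(aⁱb)^{2·n·k} | i ≥ 1 } over {a,b} belongs to L(CD_{n+1}, CF−λ, (t∧=k+1)), i.e., it can be generated by a CD grammar system with n+1 λ-free context-free components working in the (t∧=k+1)-mode. -/

import Mathlib

namespace CDHybrid

/-- Symbols: nonterminals are natural numbers, terminals come from `T`. -/
abbrev Symb (T : Type) := ℕ ⊕ T

/-- Sentential forms. -/
abbrev SForm (T : Type) := List (Symb T)

/-- A context-free rule `A → z`. -/
abbrev Rule (T : Type) := ℕ × SForm T

/-- Number of nonterminal occurrences in a sentential form. -/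
def ntCount {T : Type} (x : SForm T) : ℕ := (x.filter Sum.isLeft).length

/-- One rewriting step using some rule of the rule set `P`. -/
def RStep {T : Type} (P : List (Rule T)) (x y : SForm T) : Prop :=
  ∃ r ∈ P, ∃ u v : SForm T, x = u ++ Sum.inl r.1 :: v ∧ y = u ++ r.2 ++ v

/-- `m`-step derivation using only rules of `P`. -/
def StepsN {T : Type} (P : List (Rule T)) : ℕ → SForm T → SForm T → Prop
  | 0, x, y => x = y
  | m + 1, x, y => ∃ z, RStep P x z ∧ StepsN P m z y

/-- `m`-step derivation using only rules of `P`, all intermediate (and the final)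
sentential forms having at most `b` occurrences of nonterminals. -/
def StepsNB {T : Type} (P : List (Rule T)) (b : ℕ) : ℕ → SForm T → SForm T → Prop
  | 0, x, y => x = y
  | m + 1, x, y => ∃ z, RStep P x z ∧ ntCount z ≤ b ∧ StepsNB P b m z y

/-- Derivation modes of CD grammar systems. -/
inductive Mode where
  | eq : ℕ → Mode
  | le : ℕ → Mode
  | ge : ℕ → Mode
  | star : Mode
  | t : Mode
  | conj : Mode → Mode → Mode

/-- The predicate of a derivation mode: `modeOK P f m y` holds if an `m`-step
derivation by the component `P` ending in `y` is acceptable for mode `f`. -/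
def modeOK {T : Type} (P : List (Rule T)) : Mode → ℕ → SForm T → Prop
  | .eq k, m, _ => m = k
  | .le k, m, _ => m ≤ k
  | .ge k, m, _ => k ≤ m
  | .star, _, _ => True
  | .t, _, y => ¬ ∃ z, RStep P y z
  | .conj f g, m, y => modeOK P f m y ∧ modeOK P g m y

/-- A CD grammar system with context-free components. -/
structure CDGS (T : Type) where
  deg : ℕ
  start : ℕ
  comp : Fin deg → List (Rule T)

/-- λ-freeness: no erasing rules. -/
def CDGS.LamFree {T : Type} (G : CDGS T) : Prop :=
  ∀ i : Fin G.deg, ∀ r ∈ G.comp i, r.2 ≠ []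

/-- One derivation step of a component of `G` in mode `f`. -/
def CDGS.ModeStep {T : Type} (G : CDGS T) (f : Mode) (x y : SForm T) : Prop :=
  ∃ i : Fin G.deg, ∃ m : ℕ, StepsN (G.comp i) m x y ∧ modeOK (G.comp i) f m y

/-- One derivation step of a component of `G` in mode `f`, with all produced
sentential forms having at most `b` nonterminal occurrences. -/
def CDGS.ModeStepB {T : Type} (G : CDGS T) (f : Mode) (b : ℕ) (x y : SForm T) : Prop :=
  ∃ i : Fin G.deg, ∃ m : ℕ, StepsNB (G.comp i) b m x y ∧ modeOK (G.comp i) f m y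

/-- The language generated by `G` in mode `f`. -/
def CDGS.lang {T : Type} (G : CDGS T) (f : Mode) : Set (List T) :=
  { w | Relation.TransGen (G.ModeStep f) [Sum.inl G.start] (w.map Sum.inr) }

/-- The words of the language of `G` in mode `f` possessing a derivation of index
at most `b`, i.e., all sentential forms occurring in it have at most `b`
nonterminal occurrences. -/
def CDGS.langB {T : Type} (G : CDGS T) (f : Mode) (b : ℕ) : Set (List T) :=
  { w | ntCount ([Sum.inl G.start] : SForm T) ≤ b ∧
      Relation.TransGen (G.ModeStepB f b) [Sum.inl G.start] (w.map Sum.inr) }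

/-- Two languages are considered equal iff they differ at most in the empty word. -/
def EqL {T : Type} (L₁ L₂ : Set (List T)) : Prop := L₁ \ {[]} = L₂ \ {[]}

/-- The family `L(CD_n, CF[−λ], f)`; `lf = true` forbids erasing rules. -/
def CDFam (T : Type) (lf : Bool) (n : ℕ) (f : Mode) : Set (Set (List T)) :=
  { L | ∃ G : CDGS T, G.deg ≤ n ∧ (lf = true → G.LamFree) ∧ EqL (G.lang f) L }

/-- The family `L(CD_∞, CF[−λ], f)`. -/
def CDFamInf (T : Type) (lf : Bool) (f : Mode) : Set (Set (List T)) :=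
  { L | ∃ G : CDGS T, (lf = true → G.LamFree) ∧ EqL (G.lang f) L }

/-- The family `L_m(CD_n, CF[−λ], f)` of such languages of index at most `m`. -/
def CDFamInd (T : Type) (lf : Bool) (n : ℕ) (f : Mode) (m : ℕ) : Set (Set (List T)) :=
  { L | ∃ G : CDGS T, G.deg ≤ n ∧ (lf = true → G.LamFree) ∧ EqL (G.lang f) L ∧
      G.lang f ⊆ G.langB f m }

/-- The family `L_m(CD_∞, CF[−λ], f)`. -/
def CDFamIndInf (T : Type) (lf : Bool) (f : Mode) (m : ℕ) : Set (Set (List T)) :=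
  { L | ∃ G : CDGS T, (lf = true → G.LamFree) ∧ EqL (G.lang f) L ∧ G.lang f ⊆ G.langB f m }

/-- The family `L_fin(CD_∞, CF[−λ], f)`. -/
def CDFamFinInf (T : Type) (lf : Bool) (f : Mode) : Set (Set (List T)) :=
  { L | ∃ m : ℕ, 1 ≤ m ∧ L ∈ CDFamIndInf T lf f m }

/-- A context-free grammar. -/
structure CFG (T : Type) where
  start : ℕ
  rules : List (Rule T)

/-- The language generated by a context-free grammar. -/
def CFG.lang {T : Type} (G : CFG T) : Set (List T) :=
  { w | Relation.ReflTransGen (RStep G.rules) [Sum.inl G.start] (w.map Sum.inr) }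

/-- The words of `G.lang` having a derivation of index at most `m`. -/
def CFG.langB {T : Type} (G : CFG T) (m : ℕ) : Set (List T) :=
  { w | ntCount ([Sum.inl G.start] : SForm T) ≤ m ∧
      Relation.ReflTransGen (fun x y => RStep G.rules x y ∧ ntCount y ≤ m)
        [Sum.inl G.start] (w.map Sum.inr) }

/-- The family `L(CF)` of context-free languages. -/
def CFFam (T : Type) : Set (Set (List T)) := { L | ∃ G : CFG T, EqL G.lang L }

/-- The family `L_m(CF)` of context-free languages of index at most `m`. -/
def CFFamInd (T : Type) (m : ℕ) : Set (Set (List T)) :=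
  { L | ∃ G : CFG T, EqL G.lang L ∧ G.lang ⊆ G.langB m }

/-- The family `L_fin(CF)` of context-free languages of finite index. -/
def CFFamFin (T : Type) : Set (Set (List T)) :=
  { L | ∃ m : ℕ, 1 ≤ m ∧ L ∈ CFFamInd T m }

/-- A grammar is linear if every right-hand side contains at most one nonterminal. -/
def CFG.Linear {T : Type} (G : CFG T) : Prop := ∀ r ∈ G.rules, ntCount r.2 ≤ 1

/-- The family `L(LIN)` of linear context-free languages. -/
def LinFam (T : Type) : Set (Set (List T)) :=
  { L | ∃ G : CFG T, G.Linear ∧ EqL G.lang L }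

/-- The family `L(FIN)` of finite languages. -/
def FinFam (T : Type) : Set (Set (List T)) := { L | L.Finite }

/-- A programmed grammar with context-free rules. -/
structure PG (T : Type) where
  start : ℕ
  nLab : ℕ
  rule : Fin nLab → Rule T
  succ : Fin nLab → Set (Fin nLab)
  fail : Fin nLab → Set (Fin nLab)

def PG.LamFree {T : Type} (G : PG T) : Prop := ∀ r : Fin G.nLab, (G.rule r).2 ≠ []

/-- No appearance checking: all failure fields are empty. -/
def PG.NoAC {T : Type} (G : PG T) : Prop := ∀ r : Fin G.nLab, G.fail r = ∅

/-- One step of a programmed grammar on pairs (sentential form, label). -/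
def PG.PStep {T : Type} (G : PG T) (p q : SForm T × Fin G.nLab) : Prop :=
  (∃ u v : SForm T, p.1 = u ++ Sum.inl (G.rule p.2).1 :: v ∧
      q.1 = u ++ (G.rule p.2).2 ++ v ∧ q.2 ∈ G.succ p.2) ∨
  (Sum.inl (G.rule p.2).1 ∉ p.1 ∧ q.1 = p.1 ∧ q.2 ∈ G.fail p.2)

/-- The language generated by a programmed grammar. -/
def PG.lang {T : Type} (G : PG T) : Set (List T) :=
  { w | ∃ r₁ r₂ : Fin G.nLab,
      Relation.ReflTransGen G.PStep ([Sum.inl G.start], r₁) (w.map Sum.inr, r₂) }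

/-- The words of `G.lang` having a derivation of index at most `m`. -/
def PG.langB {T : Type} (G : PG T) (m : ℕ) : Set (List T) :=
  { w | ∃ r₁ r₂ : Fin G.nLab, ntCount ([Sum.inl G.start] : SForm T) ≤ m ∧
      Relation.ReflTransGen (fun p q => G.PStep p q ∧ ntCount q.1 ≤ m)
        ([Sum.inl G.start], r₁) (w.map Sum.inr, r₂) }

/-- The family `L_m(P, CF[−λ][, ac])`: programmed languages of index at most `m`;
`ac = false` forbids appearance checking, `lf = true` forbids erasing rules. -/
def PFamInd (T : Type) (lf ac : Bool) (m : ℕ) : Set (Set (List T)) :=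
  { L | ∃ G : PG T, (lf = true → G.LamFree) ∧ (ac = false → G.NoAC) ∧
      EqL G.lang L ∧ G.lang ⊆ G.langB m }

/-- The family `L_fin(P, CF[−λ][, ac])` of programmed languages of finite index. -/
def PFamFin (T : Type) (lf ac : Bool) : Set (Set (List T)) :=
  { L | ∃ m : ℕ, 1 ≤ m ∧ L ∈ PFamInd T lf ac m }


/-- The word b(aⁱb)^{2m}, where a is encoded as 0 and b as 1. -/
def sepWord (m i : ℕ) : List ℕ :=
  1 :: (List.replicate (2 * m) (List.replicate i 0 ++ [1])).flatten

/-- The language S_m = { b(aⁱb)^{2m} | i ≥ 1 } over {a,b}. -/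
def sepLang (m : ℕ) : Set (List ℕ) := { w | ∃ i : ℕ, 1 ≤ i ∧ w = sepWord m i }

inductive Item where
  | ctl : ℕ → ℕ → Item
  | live : ℕ → Item
  | dead : ℕ → Item
deriving DecidableEq

def iPre (n : ℕ) : Item → SForm ℕ
  | .ctl _ _ => []
  | .live s => List.replicate (s / n) (Sum.inr 0)
  | .dead s => List.replicate (s / n + 1) (Sum.inr 0)

def iPost (n : ℕ) : Item → SForm ℕ
  | .ctl _ _ => []
  | .live s => List.replicate (s / n) (Sum.inr 0) ++ [Sum.inr 1]
  | .dead s => List.replicate (s / n + 1) (Sum.inr 0) ++ [Sum.inr 1]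

def iSym (n : ℕ) : Item → Symb ℕ
  | .ctl f t => if f < 2 then Sum.inl (Nat.pair f (t % (n * (n + 1)))) else Sum.inr 1
  | .live s => Sum.inl (Nat.pair 2 (s % (n + 1)))
  | .dead _ => Sum.inr 1

def iRen (n : ℕ) (i : Item) : SForm ℕ := iPre n i ++ iSym n i :: iPost n i

def ren (n : ℕ) (l : List Item) : SForm ℕ := l.flatMap (iRen n)

def En (n c : ℕ) : Item → Bool
  | .ctl f t => f < 2 ∧ t % (n + 1) = c
  | .live s => s % (n + 1) = c
  | .dead _ => false

inductive ISt (n c : ℕ) : Item → Item → Prop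
  | c00 (t : ℕ) : t % (n + 1) = c → ISt n c (.ctl 0 t) (.ctl 0 (t + 1))
  | c01 (t : ℕ) : t % (n + 1) = c → n ∣ t + 1 → ISt n c (.ctl 0 t) (.ctl 1 (t + 1))
  | c11 (t : ℕ) : t % (n + 1) = c → ¬ n ∣ t + 1 → ISt n c (.ctl 1 t) (.ctl 1 (t + 1))
  | c12 (t : ℕ) : t % (n + 1) = c → n ∣ t + 1 → ISt n c (.ctl 1 t) (.ctl 2 (t + 1))
  | mv (s : ℕ) : s % (n + 1) = c → ISt n c (.live s) (.live (s + n))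
  | die (s : ℕ) : s % (n + 1) = c → ISt n c (.live s) (.dead s)

def initSlots (k : ℕ) : ℕ → List Item
  | 0 => []
  | n + 1 => initSlots k n ++ List.replicate k (.live n)

def ctlRules (n c : ℕ) : List (Rule ℕ) :=
  (List.range (n * (n + 1))).flatMap fun t =>
    if t % (n + 1) = c then
      (Nat.pair 0 t, [Sum.inl (Nat.pair 0 ((t + 1) % (n * (n + 1))))]) ::
      (if n ∣ t + 1 then
        [(Nat.pair 0 t, [Sum.inl (Nat.pair 1 ((t + 1) % (n * (n + 1))))]),
         (Nat.pair 1 t, [Sum.inr 1])]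
       else [(Nat.pair 1 t, [Sum.inl (Nat.pair 1 ((t + 1) % (n * (n + 1))))])])
    else []

def slotRules (n c : ℕ) : List (Rule ℕ) :=
  [(Nat.pair 2 c, [Sum.inr 0, Sum.inl (Nat.pair 2 ((c + n) % (n + 1))), Sum.inr 0]),
   (Nat.pair 2 c, [Sum.inr 0, Sum.inr 1, Sum.inr 0])]

def startRules (n k c : ℕ) : List (Rule ℕ) :=
  if c = n then
    (Nat.pair 3 k, ren n (.ctl 0 0 :: initSlots k n)) ::
    (Nat.pair 3 k, ren n (.ctl 1 0 :: initSlots k n)) ::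
    (List.range k).map fun j => (Nat.pair 3 j, [Sum.inl (Nat.pair 3 (j + 1))])
  else []

def theComp (n k c : ℕ) : List (Rule ℕ) := ctlRules n c ++ slotRules n c ++ startRules n k c

def theG (n k : ℕ) : CDGS ℕ where
  deg := n + 1
  start := Nat.pair 3 0
  comp := fun c => theComp n k c.val

theorem iRen_ne (n : ℕ) (i : Item) : iRen n i ≠ [] := by simp [iRen]

theorem theG_lf (n k : ℕ) : (theG n k).LamFree := by
  intro i r hr
  change r ∈ theComp n k i.val at hr
  simp only [theComp, List.mem_append] at hr
  rcases hr with (hr | hr) | hr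
  · simp only [ctlRules, List.mem_flatMap] at hr
    obtain ⟨t, -, hr⟩ := hr
    split_ifs at hr <;> simp at hr
    · rcases hr with rfl | rfl | rfl <;> simp
    · rcases hr with rfl | rfl <;> simp
  · simp only [slotRules, List.mem_cons, List.not_mem_nil, or_false] at hr
    rcases hr with rfl | rfl <;> simp
  · simp only [startRules] at hr
    split_ifs at hr
    · simp only [List.mem_cons, List.mem_map] at hr
      rcases hr with rfl | rfl | ⟨j, -, rfl⟩
      · simp [ren, iRen_ne]
      · simp [ren, iRen_ne]
      · simp
    · simp at hr

def Tml (p : SForm ℕ) : Prop := ∀ x ∈ p, ∃ a, x = Sum.inr a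

theorem tml_split {p x u v : SForm ℕ} {A : ℕ} (hp : Tml p) (h : p ++ x = u ++ Sum.inl A :: v) :
    ∃ u', u = p ++ u' ∧ x = u' ++ Sum.inl A :: v := by
  induction p generalizing u with
  | nil => exact ⟨u, rfl, h⟩
  | cons a p ih =>
    obtain ⟨b, rfl⟩ := hp a (by simp)
    cases u with
    | nil => simp at h
    | cons c u =>
      simp only [List.cons_append, List.cons.injEq] at h
      obtain ⟨rfl, h⟩ := h
      obtain ⟨u', rfl, h2⟩ := ih (fun x hx => hp x (by simp [hx])) h
      exact ⟨u', rfl, h2⟩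

theorem tml_pre (n : ℕ) (i : Item) : Tml (iPre n i) := by
  intro x hx
  cases i <;> simp [iPre] at hx <;> simp [hx]

theorem tml_post (n : ℕ) (i : Item) : Tml (iPost n i) := by
  intro x hx
  cases i <;> simp [iPost] at hx <;> rcases hx with hx | hx <;> simp [hx]

theorem ren_split {n : ℕ} {l : List Item} {u v : SForm ℕ} {A : ℕ}
    (h : ren n l = u ++ Sum.inl A :: v) :
    ∃ l1 i l2, l = l1 ++ i :: l2 ∧ iSym n i = Sum.inl A ∧ u = ren n l1 ++ iPre n i ∧
      v = iPost n i ++ ren n l2 := by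
  induction l generalizing u with
  | nil => simp [ren] at h
  | cons i l ih =>
    have h' : iPre n i ++ (iSym n i :: (iPost n i ++ ren n l)) = u ++ Sum.inl A :: v := by
      rw [← h]; simp [ren, iRen]
    obtain ⟨u1, rfl, h1⟩ := tml_split (tml_pre n i) h'
    cases u1 with
    | nil =>
      simp only [List.nil_append, List.cons.injEq] at h1
      exact ⟨[], i, l, rfl, h1.1, by simp [ren], h1.2.symm⟩
    | cons a u1 =>
      simp only [List.cons_append, List.cons.injEq] at h1
      obtain ⟨rfl, h1⟩ := h1
      obtain ⟨u2, rfl, h2⟩ := tml_split (tml_post n i) h1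
      obtain ⟨l1, j, l2, rfl, h3, rfl, rfl⟩ := ih h2
      exact ⟨i :: l1, j, l2, rfl, h3, by simp [ren, iRen], rfl⟩

theorem mem_ctl {n c : ℕ} {r : Rule ℕ} : r ∈ ctlRules n c ↔
    ∃ t, t < n * (n + 1) ∧ t % (n + 1) = c ∧
      (r = (Nat.pair 0 t, [Sum.inl (Nat.pair 0 ((t + 1) % (n * (n + 1))))]) ∨
       (n ∣ t + 1 ∧ r = (Nat.pair 0 t, [Sum.inl (Nat.pair 1 ((t + 1) % (n * (n + 1))))])) ∨
       (n ∣ t + 1 ∧ r = (Nat.pair 1 t, [Sum.inr 1])) ∨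
       (¬ n ∣ t + 1 ∧ r = (Nat.pair 1 t, [Sum.inl (Nat.pair 1 ((t + 1) % (n * (n + 1))))]))) := by
  simp only [ctlRules, List.mem_flatMap, List.mem_range]
  refine exists_congr fun t => and_congr_right fun _ => ?_
  split_ifs with h1 h2 <;> simp [h1, *]

theorem mem_start {n k c : ℕ} {r : Rule ℕ} : r ∈ startRules n k c ↔
    c = n ∧ (r = (Nat.pair 3 k, ren n (.ctl 0 0 :: initSlots k n)) ∨
      r = (Nat.pair 3 k, ren n (.ctl 1 0 :: initSlots k n)) ∨
      ∃ j < k, r = (Nat.pair 3 j, [Sum.inl (Nat.pair 3 (j + 1))])) := by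
  simp only [startRules]
  split_ifs with h
  · simp only [List.mem_cons, List.mem_map, List.mem_range, h, true_and]
    simp only [eq_comm]
  · simp [h]

theorem add_aux (n s : ℕ) : (s % (n + 1) + n) % (n + 1) = (s + n) % (n + 1) := by simp

theorem modM (n t : ℕ) : t % (n * (n + 1)) % (n + 1) = t % (n + 1) :=
  Nat.mod_mod_of_dvd _ (Dvd.intro_left n rfl)

theorem dvdM (n t : ℕ) : n ∣ t % (n * (n + 1)) + 1 ↔ n ∣ t + 1 := by
  have h : t % (n * (n + 1)) % n = t % n := Nat.mod_mod_of_dvd _ (Dvd.intro _ rfl)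
  rw [Nat.dvd_iff_mod_eq_zero, Nat.dvd_iff_mod_eq_zero, Nat.add_mod, h, ← Nat.add_mod]

theorem succM (n t : ℕ) : (t % (n * (n + 1)) + 1) % (n * (n + 1)) = (t + 1) % (n * (n + 1)) := by
  simp

theorem ren_mv (n s : ℕ) (hn : 1 ≤ n) : iPre n (.live s) ++
    [Sum.inr 0, Sum.inl (Nat.pair 2 ((s % (n + 1) + n) % (n + 1))), Sum.inr 0] ++ iPost n (.live s)
    = iRen n (.live (s + n)) := by
  have h : (s + n) / n = s / n + 1 := Nat.add_div_right s hn
  have h2 := add_aux n s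
  simp only [iRen, iPre, iPost, iSym, h, h2]
  have e : List.replicate (s / n + 1) (Sum.inr 0 : Symb ℕ) ++ [Sum.inr 1]
      = Sum.inr 0 :: (List.replicate (s / n) (Sum.inr 0) ++ [Sum.inr 1]) := rfl
  rw [e, List.replicate_succ']
  simp

theorem ren_die (n s : ℕ) : iPre n (.live s) ++
    [Sum.inr 0, Sum.inr 1, Sum.inr 0] ++ iPost n (.live s) = iRen n (.dead s) := by
  simp only [iRen, iPre, iPost, iSym]
  have e : List.replicate (s / n + 1) (Sum.inr 0 : Symb ℕ) ++ [Sum.inr 1]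
      = Sum.inr 0 :: (List.replicate (s / n) (Sum.inr 0) ++ [Sum.inr 1]) := rfl
  rw [e, List.replicate_succ']
  simp

theorem rule_inv {n k c : ℕ} (hn : 1 ≤ n) {i : Item} {r : Rule ℕ} (hs : iSym n i = Sum.inl r.1)
    (hr : r ∈ theComp n k c) :
    ∃ i', ISt n c i i' ∧ iPre n i ++ r.2 ++ iPost n i = iRen n i' := by
  simp only [theComp, List.mem_append] at hr
  cases i with
  | dead s => simp [iSym] at hs
  | live s =>
    simp only [iSym, Sum.inl.injEq] at hs
    rcases hr with (hr | hr) | hr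
    · obtain ⟨t, -, -, h⟩ := mem_ctl.1 hr
      rcases h with rfl | ⟨-, rfl⟩ | ⟨-, rfl⟩ | ⟨-, rfl⟩ <;> simp [Nat.pair_eq_pair] at hs
    · simp only [slotRules, List.mem_cons, List.not_mem_nil, or_false] at hr
      rcases hr with rfl | rfl
      · simp only [Nat.pair_eq_pair, true_and] at hs
        subst hs
        exact ⟨_, .mv s rfl, ren_mv n s hn⟩
      · simp only [Nat.pair_eq_pair, true_and] at hs
        subst hs
        exact ⟨_, .die s rfl, ren_die n s⟩
    · obtain ⟨-, h⟩ := mem_start.1 hr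
      rcases h with rfl | rfl | ⟨j, -, rfl⟩ <;> simp [Nat.pair_eq_pair] at hs
  | ctl f t =>
    simp only [iSym] at hs
    split_ifs at hs with hf
    simp only [Sum.inl.injEq] at hs
    rcases hr with (hr | hr) | hr
    · obtain ⟨t', -, ht, h⟩ := mem_ctl.1 hr
      rcases h with rfl | ⟨hd, rfl⟩ | ⟨hd, rfl⟩ | ⟨hd, rfl⟩ <;>
        simp only [Nat.pair_eq_pair] at hs <;> obtain ⟨rfl, rfl⟩ := hs <;>
        rw [modM] at ht <;> try rw [dvdM] at hd
      · exact ⟨_, .c00 t ht, by simp [iRen, iPre, iPost, iSym]⟩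
      · exact ⟨_, .c01 t ht hd, by simp [iRen, iPre, iPost, iSym]⟩
      · exact ⟨_, .c12 t ht hd, by simp [iRen, iPre, iPost, iSym]⟩
      · exact ⟨_, .c11 t ht hd, by simp [iRen, iPre, iPost, iSym]⟩
    · simp only [slotRules, List.mem_cons, List.not_mem_nil, or_false] at hr
      rcases hr with rfl | rfl <;> simp [Nat.pair_eq_pair] at hs <;> omega
    · obtain ⟨-, h⟩ := mem_start.1 hr
      rcases h with rfl | rfl | ⟨j, -, rfl⟩ <;> simp [Nat.pair_eq_pair] at hs <;> omega

theorem rule_fwd {n k c : ℕ} (hn : 1 ≤ n) {i i' : Item} (h : ISt n c i i') :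
    ∃ r ∈ theComp n k c, iSym n i = Sum.inl r.1 ∧ iPre n i ++ r.2 ++ iPost n i = iRen n i' := by
  have hM : 0 < n * (n + 1) := by positivity
  simp only [theComp, List.mem_append]
  cases h with
  | c00 t h => exact ⟨_, Or.inl (Or.inl (mem_ctl.2 ⟨t % (n * (n + 1)), Nat.mod_lt _ hM,
      by rwa [modM], Or.inl rfl⟩)), by simp [iSym], by simp [iRen, iPre, iPost, iSym]⟩
  | c01 t h hd => exact ⟨_, Or.inl (Or.inl (mem_ctl.2 ⟨t % (n * (n + 1)), Nat.mod_lt _ hM,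
      by rwa [modM], Or.inr (Or.inl ⟨by rwa [dvdM], rfl⟩)⟩)), by simp [iSym],
      by simp [iRen, iPre, iPost, iSym]⟩
  | c11 t h hd => exact ⟨_, Or.inl (Or.inl (mem_ctl.2 ⟨t % (n * (n + 1)), Nat.mod_lt _ hM,
      by rwa [modM], Or.inr (Or.inr (Or.inr ⟨by rwa [dvdM], rfl⟩))⟩)), by simp [iSym],
      by simp [iRen, iPre, iPost, iSym]⟩
  | c12 t h hd => exact ⟨_, Or.inl (Or.inl (mem_ctl.2 ⟨t % (n * (n + 1)), Nat.mod_lt _ hM,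
      by rwa [modM], Or.inr (Or.inr (Or.inl ⟨by rwa [dvdM], rfl⟩))⟩)), by simp [iSym],
      by simp [iRen, iPre, iPost, iSym]⟩
  | mv s h =>
    subst h
    exact ⟨_, Or.inl (Or.inr (by simp only [slotRules, List.mem_cons]; exact Or.inl rfl)),
      by simp [iSym], ren_mv n s hn⟩
  | die s h =>
    subst h
    exact ⟨_, Or.inl (Or.inr (by
      simp only [slotRules, List.mem_cons]; exact Or.inr (Or.inl rfl))),
      by simp [iSym], ren_die n s⟩

theorem ISt_en {n c : ℕ} (hn : 1 ≤ n) {i i' : Item} (h : ISt n c i i') :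
    En n c i = true ∧ En n c i' = false := by
  have aux : ∀ t, (t + 1) % (n + 1) ≠ t % (n + 1) := by
    intro t h
    have h2 : (t + 1) ≡ (t + 0) [MOD (n + 1)] := h
    have h3 := Nat.ModEq.add_left_cancel' _ h2
    rw [Nat.ModEq, Nat.zero_mod, Nat.mod_eq_of_lt (by omega)] at h3
    omega
  have aux2 : ∀ t, (t + n) % (n + 1) ≠ t % (n + 1) := by
    intro t h
    have h2 : (t + n) ≡ (t + 0) [MOD (n + 1)] := h
    have h3 := Nat.ModEq.add_left_cancel' _ h2
    rw [Nat.ModEq, Nat.zero_mod, Nat.mod_eq_of_lt (by omega)] at h3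
    omega
  cases h <;> subst_vars <;> simp [En, aux, aux2]

theorem step_inv {n k c : ℕ} (hn : 1 ≤ n) {l : List Item} {y : SForm ℕ}
    (h : RStep (theComp n k c) (ren n l) y) :
    ∃ l1 i i' l2, l = l1 ++ i :: l2 ∧ ISt n c i i' ∧ y = ren n (l1 ++ i' :: l2) := by
  obtain ⟨r, hr, u, v, hx, rfl⟩ := h
  obtain ⟨l1, i, l2, rfl, hs, rfl, rfl⟩ := ren_split hx
  obtain ⟨i', h1, h2⟩ := rule_inv hn hs hr
  refine ⟨l1, i, i', l2, rfl, h1, ?_⟩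
  simp only [ren, List.flatMap_append, List.flatMap_cons, ← h2]
  simp

theorem f2_append {R : Item → Item → Prop} {a b : List Item} {l : List Item}
    (h : List.Forall₂ R (a ++ b) l) :
    ∃ a' b', List.Forall₂ R a a' ∧ List.Forall₂ R b b' ∧ l = a' ++ b' := by
  induction a generalizing l with
  | nil => exact ⟨[], l, .nil, h, rfl⟩
  | cons x a ih =>
    cases h with
    | cons h1 h2 =>
      obtain ⟨a', b', ha, hb, rfl⟩ := ih h2
      exact ⟨_ :: a', b', .cons h1 ha, hb, rfl⟩

theorem steps_inv {n k c : ℕ} (hn : 1 ≤ n) (m : ℕ) {l : List Item} {y : SForm ℕ}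
    (h : StepsN (theComp n k c) m (ren n l) y) :
    ∃ l', y = ren n l' ∧ List.Forall₂ (fun i i' => i' = i ∨ ISt n c i i') l l' ∧
      l.countP (En n c) = m + l'.countP (En n c) := by
  induction m generalizing l with
  | zero =>
    refine ⟨l, h.symm, ?_, by simp⟩
    exact List.forall₂_same.2 fun _ _ => Or.inl rfl
  | succ m ih =>
    obtain ⟨z, hz, h⟩ := h
    obtain ⟨l1, i, i', l2, rfl, h1, rfl⟩ := step_inv hn hz
    obtain ⟨l', rfl, h2, h3⟩ := ih h
    refine ⟨l', rfl, ?_, ?_⟩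
    · obtain ⟨a, b, ha, hb, rfl⟩ := f2_append h2
      refine List.rel_append ha ?_
      cases hb with
      | cons hb hb' =>
        refine List.Forall₂.cons ?_ hb'
        rcases hb with rfl | hb
        · exact Or.inr h1
        · have e1 := (ISt_en hn h1).2
          have e2 := (ISt_en hn hb).1
          rw [e1] at e2; cases e2
    · have e := ISt_en hn h1
      simp only [List.countP_append, List.countP_cons, e.1, e.2] at h3 ⊢
      simp at h3 ⊢
      omega

theorem stepsN_ctx {P : List (Rule ℕ)} (p q : SForm ℕ) (m : ℕ) {x y : SForm ℕ}
    (h : StepsN P m x y) : StepsN P m (p ++ x ++ q) (p ++ y ++ q) := by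
  induction m generalizing x with
  | zero => cases h; rfl
  | succ m ih =>
    obtain ⟨z, ⟨r, hr, u, v, rfl, rfl⟩, h⟩ := h
    exact ⟨_, ⟨r, hr, p ++ u, v ++ q, by simp, by simp⟩, ih h⟩

theorem stepsN_trans {P : List (Rule ℕ)} (a b : ℕ) {x y z : SForm ℕ}
    (h : StepsN P a x y) (h2 : StepsN P b y z) : StepsN P (a + b) x z := by
  induction a generalizing x with
  | zero => cases h; simpa using h2
  | succ a ih =>
    obtain ⟨w, hw, h⟩ := h
    rw [Nat.add_right_comm]
    exact ⟨w, hw, ih h⟩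

theorem steps_fwd {n k c : ℕ} (hn : 1 ≤ n) {l l' : List Item}
    (h : List.Forall₂ (fun i i' => (En n c i = false ∧ i' = i) ∨ ISt n c i i') l l') :
    StepsN (theComp n k c) (l.countP (En n c)) (ren n l) (ren n l') ∧
      ∀ i ∈ l', En n c i = false := by
  induction h with
  | nil => exact ⟨rfl, by simp⟩
  | @cons i i' l l' h1 h2 ih =>
    obtain ⟨ih, ihe⟩ := ih
    have key : StepsN (theComp n k c) (if En n c i then 1 else 0) (iRen n i) (iRen n i') ∧
        En n c i' = false := by
      rcases h1 with ⟨h, rfl⟩ | h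
      · simp [h, StepsN]
      · refine ⟨?_, (ISt_en hn h).2⟩
        rw [(ISt_en hn h).1]
        obtain ⟨r, hr, hs, he⟩ := rule_fwd (k := k) hn h
        exact ⟨_, ⟨r, hr, iPre n i, iPost n i, by rw [iRen, hs], rfl⟩, he⟩
    refine ⟨?_, by simpa [key.2] using ihe⟩
    have a := stepsN_ctx [] (ren n l) _ key.1
    have b := stepsN_ctx (iRen n i') [] _ ih
    simp only [List.nil_append, List.append_nil] at a b
    rw [List.countP_cons, add_comm]
    exact stepsN_trans _ _ a b

abbrev theMode (k : ℕ) : Mode := Mode.conj Mode.t (Mode.eq (k + 1))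

theorem not_step {n k c : ℕ} (hn : 1 ≤ n) {l : List Item} (h : ∀ i ∈ l, En n c i = false) :
    ¬ ∃ z, RStep (theComp n k c) (ren n l) z := by
  rintro ⟨z, hz⟩
  obtain ⟨l1, i, i', l2, rfl, h1, rfl⟩ := step_inv hn hz
  have := h i (by simp)
  rw [(ISt_en hn h1).1] at this
  cases this

theorem mode_fwd {n k c : ℕ} (hn : 1 ≤ n) (hc : c < n + 1) {l l' : List Item}
    (h : List.Forall₂ (fun i i' => (En n c i = false ∧ i' = i) ∨ ISt n c i i') l l')
    (hk : l.countP (En n c) = k + 1) :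
    (theG n k).ModeStep (theMode k) (ren n l) (ren n l') := by
  obtain ⟨h1, h2⟩ := steps_fwd (k := k) hn h
  rw [hk] at h1
  exact ⟨⟨c, hc⟩, k + 1, h1, not_step hn h2, rfl⟩

/-! start -/

theorem start_step {n k c j : ℕ} {y : SForm ℕ}
    (h : RStep (theComp n k c) [Sum.inl (Nat.pair 3 j)] y) :
    (j < k ∧ y = [Sum.inl (Nat.pair 3 (j + 1))]) ∨
    (j = k ∧ ∃ f < 2, y = ren n (.ctl f 0 :: initSlots k n)) := by
  obtain ⟨r, hr, u, v, hx, rfl⟩ := h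
  have : u = [] ∧ v = [] ∧ r.1 = Nat.pair 3 j := by
    cases u with
    | nil => simp at hx; exact ⟨rfl, hx.2, hx.1.symm⟩
    | cons a u => simp at hx
  clear hx
  obtain ⟨rfl, rfl, hx⟩ := this
  simp only [theComp, List.mem_append] at hr
  rcases hr with (hr | hr) | hr
  · obtain ⟨t, -, -, h⟩ := mem_ctl.1 hr
    rcases h with rfl | ⟨-, rfl⟩ | ⟨-, rfl⟩ | ⟨-, rfl⟩ <;> simp [Nat.pair_eq_pair] at hx
  · simp only [slotRules, List.mem_cons, List.not_mem_nil, or_false] at hr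
    rcases hr with rfl | rfl <;> simp [Nat.pair_eq_pair] at hx
  · obtain ⟨-, h⟩ := mem_start.1 hr
    rcases h with rfl | rfl | ⟨j', hj, rfl⟩ <;> simp only [Nat.pair_eq_pair, true_and] at hx <;>
      subst hx
    · exact Or.inr ⟨rfl, 0, by simp, by simp⟩
    · exact Or.inr ⟨rfl, 1, by simp, by simp⟩
    · exact Or.inl ⟨hj, by simp⟩

theorem start_inv {n k c : ℕ} (d : ℕ) {j : ℕ} (hd : j + d = k) {y : SForm ℕ}
    (h : StepsN (theComp n k c) (d + 1) [Sum.inl (Nat.pair 3 j)] y) :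
    ∃ f < 2, y = ren n (.ctl f 0 :: initSlots k n) := by
  induction d generalizing j with
  | zero =>
    obtain ⟨z, hz, rfl⟩ := h
    rcases start_step hz with ⟨h, -⟩ | ⟨-, h⟩
    · omega
    · exact h
  | succ d ih =>
    obtain ⟨z, hz, h⟩ := h
    rcases start_step hz with ⟨-, rfl⟩ | ⟨h, -⟩
    · exact ih (by omega) h
    · omega

theorem start_fwd {n k : ℕ} {f : ℕ} (hf : f < 2) (d : ℕ) {j : ℕ} (hd : j + d = k) :
    StepsN (theComp n k n) (d + 1) [Sum.inl (Nat.pair 3 j)] (ren n (.ctl f 0 :: initSlots k n)) := by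
  induction d generalizing j with
  | zero =>
    have : j = k := by omega
    subst this
    refine ⟨_, ⟨(Nat.pair 3 j, ren n (.ctl f 0 :: initSlots j n)), ?_, [], [], rfl, by simp⟩, rfl⟩
    simp only [theComp, List.mem_append]
    refine Or.inr (mem_start.2 ⟨rfl, ?_⟩)
    interval_cases f <;> simp
  | succ d ih =>
    refine ⟨_, ⟨(Nat.pair 3 j, [Sum.inl (Nat.pair 3 (j + 1))]), ?_, [], [], rfl, rfl⟩,
      ih (by omega)⟩
    simp only [theComp, List.mem_append]
    exact Or.inr (mem_start.2 ⟨rfl, Or.inr (Or.inr ⟨j, by omega, rfl⟩)⟩)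

theorem init_mem {k n : ℕ} {i : Item} (h : i ∈ initSlots k n) : ∃ s < n, i = .live s := by
  induction n with
  | zero => simp [initSlots] at h
  | succ n ih =>
    simp only [initSlots, List.mem_append] at h
    rcases h with h | h
    · obtain ⟨s, hs, rfl⟩ := ih h
      exact ⟨s, by omega, rfl⟩
    · exact ⟨n, by omega, (List.mem_replicate.1 h).2⟩

theorem init_len (k n : ℕ) : (initSlots k n).length = n * k := by
  induction n with
  | zero => simp [initSlots]
  | succ n ih => simp [initSlots, ih]; ring

theorem init_count (k n s : ℕ) :
    (initSlots k n).count (.live s) = if s < n then k else 0 := by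
  induction n with
  | zero => simp [initSlots]
  | succ n ih =>
    simp only [initSlots, List.count_append, ih, List.count_replicate]
    by_cases h : s < n
    · have : n ≠ s := by omega
      simp [h, this]; omega
    · by_cases h2 : s = n
      · subst h2; simp
      · have : n ≠ s := by omega
        simp [h, this]; omega

theorem start_mode {n k f : ℕ} (hn : 1 ≤ n) (hf : f < 2) :
    (theG n k).ModeStep (theMode k) [Sum.inl (theG n k).start]
      (ren n (.ctl f 0 :: initSlots k n)) := by
  refine ⟨⟨n, Nat.lt_succ_self n⟩, k + 1, start_fwd (j := 0) hf k (by omega), not_step hn ?_, rfl⟩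
  intro i hi
  simp only [List.mem_cons] at hi
  rcases hi with rfl | hi
  · simp [En]; omega
  · obtain ⟨s, hs, rfl⟩ := init_mem hi
    simp only [En, decide_eq_false_iff_not]
    rw [Nat.mod_eq_of_lt (by omega)]; omega

/-! invariant -/

def okI (n r : ℕ) : Item → Bool
  | .ctl _ _ => false
  | .live s => (r + 1) * n ≤ s
  | .dead s => s / n = r

structure Inv (n k f t : ℕ) (l : List Item) : Prop where
  len : l.length = n * k
  noctl : ∀ f t, Item.ctl f t ∉ l
  win : ∀ s, Item.live s ∈ l → t ≤ s ∧ s < t + n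
  cnt : ∀ s, l.count (.live s) ≤ k
  fin : 1 ≤ f → ∃ r, r * n ≤ t ∧ t ≤ (r + 1) * n ∧ (f = 1 → t < (r + 1) * n) ∧
    (2 ≤ f → t = (r + 1) * n) ∧ k * (t - r * n) ≤ l.countP (okI n r)

theorem inv_init {n k f : ℕ} (hn : 1 ≤ n) (hf : f < 2) : Inv n k f 0 (initSlots k n) where
  len := init_len k n
  noctl := fun f t h => by obtain ⟨s, _, h⟩ := init_mem h; cases h
  win := fun s h => by
    obtain ⟨s', h1, h⟩ := init_mem h
    cases h; omega
  cnt := fun s => by rw [init_count]; split_ifs <;> omega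
  fin := fun _ => ⟨0, by simp, by simp, by simp; omega, by omega, by simp⟩

theorem mod_win {n t s s' : ℕ} (h1 : t ≤ s) (h2 : s < t + n) (h3 : t ≤ s') (h4 : s' < t + n)
    (h : s % (n + 1) = s' % (n + 1)) : s = s' := by
  have h' : s ≡ s' [MOD (n + 1)] := h
  rcases le_total s s' with hl | hl
  · have := (Nat.modEq_iff_dvd' hl).1 h'
    have := Nat.eq_zero_of_dvd_of_lt this (by omega)
    omega
  · have := (Nat.modEq_iff_dvd' hl).1 h'.symm
    have := Nat.eq_zero_of_dvd_of_lt this (by omega)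
    omega

theorem countP_rel {R : Item → Item → Prop} {p q r : Item → Bool} {l l' : List Item}
    (h : List.Forall₂ R l l')
    (hR : ∀ i i', R i i' → (if p i then 1 else 0) + (if q i then 1 else 0)
      ≤ (if r i' then 1 else 0)) :
    l.countP p + l.countP q ≤ l'.countP r := by
  induction h with
  | nil => simp
  | cons h1 h2 ih =>
    have := hR _ _ h1
    simp only [List.countP_cons]
    omega

theorem countP_rel' {R : Item → Item → Prop} {p r : Item → Bool} {l l' : List Item}
    (h : List.Forall₂ R l l')
    (hR : ∀ i i', R i i' → r i' = true → p i = true) :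
    l'.countP r ≤ l.countP p := by
  induction h with
  | nil => simp
  | @cons a b l l' h1 h2 ih =>
    have := hR _ _ h1
    simp only [List.countP_cons]
    cases hb : r b
    · simp; omega
    · simp [this hb]; omega

theorem inv_step {n k f t c m : ℕ} (hn : 1 ≤ n) {l : List Item} (hi : Inv n k f t l)
    {y : SForm ℕ} (hm : m = k + 1)
    (h : StepsN (theComp n k c) m (ren n (.ctl f t :: l)) y) :
    ∃ f' l', y = ren n (.ctl f' (t + 1) :: l') ∧ Inv n k f' (t + 1) l' := by
  subst hm
  obtain ⟨l1, rfl, hF, hcount⟩ := steps_inv hn _ h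
  have hslots : ∀ s, Item.live s ∈ l → s % (n + 1) = c → l.countP (En n c) ≤ k := by
    intro s hs hsc
    refine le_trans ?_ (hi.cnt s)
    rw [List.count]
    refine List.countP_mono_left fun i hil hen => ?_
    cases i with
    | ctl f t => exact absurd hil (hi.noctl _ _)
    | dead s' => simp [En] at hen
    | live s' =>
      simp only [En, decide_eq_true_eq] at hen
      have a := hi.win _ hs
      have b := hi.win _ hil
      have := mod_win a.1 a.2 b.1 b.2 (by rw [hsc, hen])
      simp [this]
  have hle : l.countP (En n c) ≤ k := by
    by_cases hex : ∃ s, Item.live s ∈ l ∧ s % (n + 1) = c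
    · obtain ⟨s, h1, h2⟩ := hex
      exact hslots s h1 h2
    · have : l.countP (En n c) = 0 := by
        rw [List.countP_eq_zero]
        intro i hil hen
        cases i with
        | ctl f t => exact absurd hil (hi.noctl _ _)
        | dead s' => simp [En] at hen
        | live s' =>
          simp only [En, decide_eq_true_eq] at hen
          exact hex ⟨s', hil, hen⟩
      omega
  cases hF with
  | @cons _ i' _ l' hc hF =>
  rw [List.countP_cons, List.countP_cons] at hcount
  have hen : En n c (.ctl f t) = true := by
    by_contra hne
    simp [hne] at hcount; omega
  simp only [hen, if_true] at hcount
  have hcl : l.countP (En n c) = k := by omega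
  have hcl' : l'.countP (En n c) = 0 := by omega
  have hei' : En n c i' = false := by
    by_contra hne
    have hne' : En n c i' = true := by simpa using hne
    rw [if_pos hne'] at hcount
    omega
  have htc : t % (n + 1) = c := by simp [En] at hen; exact hen.2
  have hst : ISt n c (.ctl f t) i' := by
    rcases hc with rfl | hc
    · rw [hen] at hei'; cases hei'
    · exact hc
  -- the slots relation
  have hR : List.Forall₂ (fun i i' => (i = .live t ∧ (i' = .live (t + n) ∨ i' = .dead t)) ∨
      (i ≠ .live t ∧ i' = i ∧ (∀ f t, i ≠ .ctl f t) ∧ ∀ s, i = .live s → t < s ∧ s < t + n))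
      l l' := by
    have hne := List.countP_eq_zero.1 hcl'
    have hF2 : List.Forall₂ (fun i i' => (i' = i ∨ ISt n c i i') ∧ i ∈ l ∧ i' ∈ l') l l' := by
      rw [List.forall₂_iff_get] at hF ⊢
      exact ⟨hF.1, fun j h1 h2 => ⟨hF.2 j h1 h2, List.get_mem _ _, List.get_mem _ _⟩⟩
    refine hF2.imp ?_
    rintro i j ⟨hij, hil, hjl⟩
    have hw : ∀ s, i = .live s → t ≤ s ∧ s < t + n := fun s hs => hi.win s (hs ▸ hil)
    rcases hij with rfl | hij
    · have hj := hne _ hjl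
      right
      have : j ≠ .live t := by
        rintro rfl
        simp [En, htc] at hj
      refine ⟨this, rfl, fun f t h => hi.noctl f t (h ▸ hil), fun s hs => ?_⟩
      have := hw s hs
      have : s ≠ t := by rintro rfl; contradiction
      omega
    · left
      cases hij with
      | c00 _ _ => exact absurd hil (hi.noctl _ _)
      | c01 _ _ _ => exact absurd hil (hi.noctl _ _)
      | c11 _ _ _ => exact absurd hil (hi.noctl _ _)
      | c12 _ _ _ => exact absurd hil (hi.noctl _ _)
      | mv s hs =>
        have a := hw s rfl
        have := mod_win a.1 a.2 (le_refl t) (by omega) (by rw [hs, htc])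
        subst this; simp
      | die s hs =>
        have a := hw s rfl
        have := mod_win a.1 a.2 (le_refl t) (by omega) (by rw [hs, htc])
        subst this; simp
  have hmem : ∀ j ∈ l', (j = .live (t + n) ∨ j = .dead t) ∨
      ((∀ f t, j ≠ .ctl f t) ∧ ∀ s, j = .live s → t < s ∧ s < t + n) := by
    intro j hj
    obtain ⟨a, ha, rfl⟩ := List.getElem_of_mem hj
    rw [List.forall₂_iff_get] at hR
    have := hR.2 a (by rw [hR.1]; exact ha) ha
    simp only [List.get_eq_getElem] at this
    rcases this with ⟨-, h⟩ | ⟨-, h, h2⟩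
    · exact Or.inl h
    · rw [h]; exact Or.inr h2
  have hct : l.countP (fun i => i == .live t) = k := by
    rw [← hcl]
    refine le_antisymm (List.countP_mono_left fun i _ h => ?_)
      (List.countP_mono_left fun i hil h => ?_)
    · simp at h; subst h; simp [En, htc]
    · cases i with
      | ctl f t => exact absurd hil (hi.noctl _ _)
      | dead s' => simp [En] at h
      | live s' =>
        simp only [En, decide_eq_true_eq] at h
        have a := hi.win _ hil
        have := mod_win a.1 a.2 (le_refl t) (by omega) (by rw [h, htc])
        simp [this]
  have common : ∀ f', (1 ≤ f' → ∃ r, r * n ≤ t + 1 ∧ t + 1 ≤ (r + 1) * n ∧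
      (f' = 1 → t + 1 < (r + 1) * n) ∧ (2 ≤ f' → t + 1 = (r + 1) * n) ∧
      k * (t + 1 - r * n) ≤ l'.countP (okI n r)) → Inv n k f' (t + 1) l' := by
    intro f' hfin
    refine ⟨?_, ?_, ?_, ?_, hfin⟩
    · rw [← hR.length_eq]; exact hi.len
    · intro f t hft
      rcases hmem _ hft with (h | h) | h
      · cases h
      · cases h
      · exact h.1 _ _ rfl
    · intro s hs
      rcases hmem _ hs with (h | h) | h
      · cases h; omega
      · cases h
      · have := h.2 s rfl; omega
    · intro s
      by_cases hs : s = t + n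
      · refine le_trans (countP_rel' (p := fun i => i == .live t) hR ?_) hct.le
        intro i i' h he
        simp only [beq_iff_eq] at he ⊢
        subst he
        rcases h with h | ⟨-, h, -, h2⟩
        · exact h.1
        · subst h
          have := h2 s rfl; omega
      · refine le_trans (countP_rel' (p := fun i => i == .live s) hR ?_) (hi.cnt s)
        intro i i' h he
        simp only [beq_iff_eq] at he ⊢
        subst he
        rcases h with ⟨-, h | h⟩ | ⟨-, h, -⟩
        · cases h; omega
        · cases h
        · exact h.symm
  have okadd : ∀ r, r * n ≤ t → t < (r + 1) * n →
      l.countP (okI n r) + k ≤ l'.countP (okI n r) := by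
    intro r hr1 hr2
    have := countP_rel (p := okI n r) (q := fun i => i == .live t) (r := okI n r) hR ?_
    · rwa [hct] at this
    · intro i i' h
      rcases h with ⟨rfl, rfl | rfl⟩ | ⟨h, rfl, -⟩
      · have e : (r + 1) * n ≤ t + n := by rw [add_mul]; omega
        have e2 : ¬ (r + 1) * n ≤ t := by omega
        simp [okI, e, e2]
      · have e : t / n = r := Nat.div_eq_of_lt_le hr1 hr2
        have e2 : ¬ (r + 1) * n ≤ t := by omega
        simp [okI, e, e2]
      · simp [h]
  have kmul : ∀ r, r * n ≤ t → k * (t + 1 - r * n) = k * (t - r * n) + k := by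
    intro r hr
    rw [show t + 1 - r * n = (t - r * n) + 1 by omega, mul_add, mul_one]
  cases hst with
  | c00 _ _ => exact ⟨0, l', rfl, common _ (by omega)⟩
  | c01 _ _ hd =>
    refine ⟨1, l', rfl, common _ fun _ => ?_⟩
    obtain ⟨r, hr⟩ := hd
    rw [mul_comm] at hr
    refine ⟨r, by omega, ?_, ?_, by omega, ?_⟩
    · rw [add_mul]; omega
    · rw [add_mul]; omega
    · rw [hr]; simp
  | c11 _ _ hd =>
    refine ⟨1, l', rfl, common _ fun _ => ?_⟩
    obtain ⟨r, h1, h2, h3, h4, h5⟩ := hi.fin le_rfl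
    have h3 := h3 rfl
    have : t + 1 ≠ (r + 1) * n := fun h => hd ⟨r + 1, by rw [h, mul_comm]⟩
    have := okadd r h1 h3
    have := kmul r h1
    exact ⟨r, by omega, by omega, by omega, by omega, by omega⟩
  | c12 _ _ hd =>
    refine ⟨2, l', rfl, common _ fun _ => ?_⟩
    obtain ⟨r, h1, h2, h3, h4, h5⟩ := hi.fin le_rfl
    have h3 := h3 rfl
    have : t + 1 = (r + 1) * n := by
      obtain ⟨q, hq⟩ := hd
      have a1 : r < q := by
        by_contra hlt
        have : q * n ≤ r * n := Nat.mul_le_mul_right _ (by omega)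
        rw [mul_comm] at hq; omega
      have : (r + 1) * n ≤ q * n := Nat.mul_le_mul_right _ (by omega)
      rw [mul_comm] at hq; omega
    have := okadd r h1 h3
    have := kmul r h1
    exact ⟨r, by omega, by omega, by omega, by omega, by omega⟩

theorem final_ren {n k r t : ℕ} {l : List Item} (hl : l.length = n * k)
    (h : ∀ i ∈ l, ∃ s, i = .dead s ∧ s / n = r) :
    ren n (.ctl 2 t :: l) = (sepWord (n * k) (r + 1)).map Sum.inr := by
  have key : ∀ l : List Item, (∀ i ∈ l, ∃ s, i = .dead s ∧ s / n = r) →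
      ren n l = (List.replicate (2 * l.length)
        (List.replicate (r + 1) 0 ++ [1])).flatten.map Sum.inr := by
    intro l
    induction l with
    | nil => intro _; simp [ren]
    | cons i l ih =>
      intro h
      obtain ⟨s, rfl, hs⟩ := h i (by simp)
      have ih := ih fun i hi => h i (by simp [hi])
      rw [show ren n (.dead s :: l) = iRen n (.dead s) ++ ren n l by simp [ren], ih,
        List.length_cons, show 2 * (l.length + 1) = 2 * l.length + 1 + 1 by ring]
      rw [List.replicate_succ (n := 2 * l.length + 1), List.replicate_succ (n := 2 * l.length)]
      simp [iRen, iPre, iPost, iSym, hs]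
  rw [show ren n (.ctl 2 t :: l) = iRen n (.ctl 2 t) ++ ren n l by simp [ren], key l h, hl]
  simp [sepWord, iRen, iPre, iPost, iSym]

theorem lang_sub {n k : ℕ} (hn : 1 ≤ n) :
    (theG n k).lang (theMode k) ⊆ sepLang (n * k) := by
  intro w hw
  have main : ∀ y, Relation.TransGen ((theG n k).ModeStep (theMode k))
      [Sum.inl (theG n k).start] y →
      ∃ f t l, y = ren n (.ctl f t :: l) ∧ Inv n k f t l := by
    intro y hy
    induction hy with
    | single h =>
      obtain ⟨c, m, h, -, hm⟩ := h
      change m = k + 1 at hm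
      subst hm
      obtain ⟨f, hf, rfl⟩ := start_inv (c := c.val) (j := 0) k (by omega) h
      exact ⟨f, 0, _, rfl, inv_init hn hf⟩
    | tail _ h ih =>
      obtain ⟨f, t, l, rfl, hi⟩ := ih
      obtain ⟨c, m, h, -, hm⟩ := h
      obtain ⟨f', l', rfl, hi'⟩ := inv_step (c := c.val) hn hi hm h
      exact ⟨f', _, l', rfl, hi'⟩
  obtain ⟨f, t, l, hy, hi⟩ := main _ hw
  have hterm : ∀ i ∈ Item.ctl f t :: l, ∀ A, iSym n i ≠ Sum.inl A := by
    intro i hil A hA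
    have : (Sum.inl A : Symb ℕ) ∈ w.map Sum.inr := by
      rw [hy, ren, List.mem_flatMap]
      exact ⟨i, hil, by simp [iRen, hA]⟩
    simp at this
  have hf : 2 ≤ f := by
    by_contra hf
    exact hterm (.ctl f t) (by simp) _ (by simp only [iSym]; rw [if_pos (by omega)])
  obtain ⟨r, h1, h2, h3, h4, h5⟩ := hi.fin (by omega)
  have h4 := h4 hf
  have hall : ∀ i ∈ l, okI n r i = true := by
    rw [← List.countP_eq_length]
    refine le_antisymm List.countP_le_length ?_
    rw [hi.len]
    refine le_trans (le_of_eq ?_) h5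
    rw [h4, add_mul, one_mul, Nat.add_sub_cancel_left, mul_comm]
  refine ⟨r + 1, by omega, ?_⟩
  have hr : ren n (.ctl 2 t :: l) = (sepWord (n * k) (r + 1)).map Sum.inr := by
    refine final_ren hi.len fun i hil => ?_
    have ho := hall i hil
    cases i with
    | ctl f t => exact absurd hil (hi.noctl _ _)
    | live s => exact absurd rfl (hterm _ (List.mem_cons_of_mem _ hil) _)
    | dead s => exact ⟨s, rfl, by simpa [okI] using ho⟩
  have h22 : ren n (.ctl f t :: l) = ren n (.ctl 2 t :: l) := by
    have : ¬ f < 2 := by omega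
    simp [ren, iRen, iPre, iPost, iSym, this]
  rw [h22, hr] at hy
  exact (List.map_injective_iff.2 Sum.inr_injective) hy

/-! forward -/

theorem fwd_step {n k t f : ℕ} (hn : 1 ≤ n) {l : List Item} {ci z : Item} (hf : f < 2)
    (hc : ISt n (t % (n + 1)) (.ctl f t) ci) (hz : ISt n (t % (n + 1)) (.live t) z)
    (hen : ∀ i ∈ l, En n (t % (n + 1)) i = true → i = .live t)
    (hcnt : l.count (.live t) = k) :
    (theG n k).ModeStep (theMode k) (ren n (.ctl f t :: l))
      (ren n (ci :: l.map fun i => if i = .live t then z else i)) := by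
  refine mode_fwd hn (Nat.mod_lt _ (by omega)) (List.Forall₂.cons (Or.inr hc) ?_) ?_
  · rw [List.forall₂_map_right_iff, List.forall₂_same]
    intro i hi
    by_cases h : i = .live t
    · subst h; simp [hz]
    · left
      simp only [h, if_false, and_true]
      by_contra hne
      exact h (hen i hi (by simpa using hne))
  · rw [List.countP_cons, (ISt_en hn hc).1, ← hcnt, List.count]
    simp only [if_true, Nat.add_right_cancel_iff]
    refine List.countP_congr fun i hi => ?_
    constructor
    · intro h; simp [hen i hi h]
    · intro h; simp at h; subst h; simp [En]

structure Good (n k t : ℕ) (l : List Item) : Prop where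
  len : l.length = n * k
  all : ∀ i ∈ l, ∃ s, i = .live s ∧ t ≤ s ∧ s < t + n
  cnt : ∀ s, t ≤ s → s < t + n → l.count (.live s) = k

theorem good_next {n k t : ℕ} (hn : 1 ≤ n) {l : List Item} (h : Good n k t l) :
    Good n k (t + 1) (l.map fun i => if i = .live t then .live (t + n) else i) where
  len := by simp [h.len]
  all := by
    intro i hi
    obtain ⟨j, hj, rfl⟩ := List.mem_map.1 hi
    obtain ⟨s, rfl, h1, h2⟩ := h.all j hj
    by_cases hs : s = t
    · subst hs; exact ⟨s + n, by simp, by omega, by omega⟩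
    · exact ⟨s, by simp [hs], by omega, by omega⟩
  cnt := by
    intro s h1 h2
    rw [List.count, List.countP_map]
    by_cases hs : s = t + n
    · subst hs
      rw [← h.cnt t le_rfl (by omega), List.count]
      refine List.countP_congr fun i hi => ?_
      obtain ⟨s, rfl, h1, h2⟩ := h.all i hi
      by_cases hs : s = t
      · simp [hs]
      · simp [hs]; omega
    · rw [← h.cnt s (by omega) (by omega), List.count]
      refine List.countP_congr fun i hi => ?_
      obtain ⟨s', rfl, h1, h2⟩ := h.all i hi
      by_cases hs' : s' = t
      · simp [hs']; omega
      · simp [hs']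

theorem good_reach {n k : ℕ} (hn : 1 ≤ n) (t f : ℕ) (hf : f = 0 ∨ f = 1 ∧ n ∣ t) :
    ∃ l, Good n k t l ∧ Relation.TransGen ((theG n k).ModeStep (theMode k))
      [Sum.inl (theG n k).start] (ren n (.ctl f t :: l)) := by
  induction t generalizing f with
  | zero =>
    refine ⟨initSlots k n, ⟨init_len k n, fun i hi => ?_, fun s _ h => ?_⟩,
      .single (start_mode hn (by omega))⟩
    · obtain ⟨s, hs, rfl⟩ := init_mem hi
      exact ⟨s, rfl, by omega, by omega⟩
    · rw [init_count, if_pos (by omega)]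
  | succ t ih =>
    obtain ⟨l, hg, hr⟩ := ih 0 (Or.inl rfl)
    refine ⟨_, good_next hn hg, hr.tail (fwd_step hn (by omega) ?_ (.mv t rfl) ?_ ?_)⟩
    · rcases hf with rfl | ⟨rfl, hd⟩
      · exact .c00 t rfl
      · exact .c01 t rfl hd
    · intro i hi he
      obtain ⟨s, rfl, h1, h2⟩ := hg.all i hi
      simp only [En, decide_eq_true_eq] at he
      rw [mod_win h1 h2 le_rfl (by omega) he]
    · exact hg.cnt t le_rfl (by omega)

theorem fin_reach {n k : ℕ} (hn : 1 ≤ n) (r d : ℕ) (hd : d ≤ n) :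
    ∃ l f, (d < n → f = 1) ∧ (d = n → f = 2) ∧ l.length = n * k ∧
      (∀ i ∈ l, (∃ s, i = .live s ∧ r * n + d ≤ s ∧ s < r * n + n) ∨
        ∃ s, i = .dead s ∧ s / n = r) ∧
      (∀ s, r * n + d ≤ s → s < r * n + n → l.count (.live s) = k) ∧
      Relation.TransGen ((theG n k).ModeStep (theMode k))
      [Sum.inl (theG n k).start] (ren n (.ctl f (r * n + d) :: l)) := by
  induction d with
  | zero =>
    obtain ⟨l, hg, hr⟩ := good_reach (k := k) hn (r * n) 1 (Or.inr ⟨rfl, Dvd.intro_left r rfl⟩)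
    exact ⟨l, 1, by simp, by omega, hg.len, fun i hi => Or.inl (hg.all i hi), hg.cnt, hr⟩
  | succ d ih =>
    obtain ⟨l, f, hf, -, hl, hall, hcnt, hr⟩ := ih (by omega)
    have := hf (by omega)
    subst this
    have hz : ISt n ((r * n + d) % (n + 1)) (.live (r * n + d)) (.dead (r * n + d)) := .die _ rfl
    have hdiv : (r * n + d) / n = r :=
      Nat.div_eq_of_lt_le (by omega) (by rw [add_mul]; omega)
    have hen : ∀ i ∈ l, En n ((r * n + d) % (n + 1)) i = true → i = .live (r * n + d) := by
      intro i hi he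
      rcases hall i hi with ⟨s, rfl, h1, h2⟩ | ⟨s, rfl, -⟩
      · simp only [En, decide_eq_true_eq] at he
        rw [mod_win (t := r * n + d) h1 (by omega) le_rfl (by omega) he]
      · simp [En] at he
    have hcd := hcnt (r * n + d) le_rfl (by omega)
    have hdv : n ∣ r * n + d + 1 ↔ d + 1 = n := by
      rw [add_assoc, Nat.dvd_add_right (Dvd.intro_left r rfl)]
      constructor
      · intro h; have := Nat.le_of_dvd (by omega) h; omega
      · rintro h; rw [h]
    have hci : ∃ f, (d + 1 < n → f = 1) ∧ (d + 1 = n → f = 2) ∧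
        ISt n ((r * n + d) % (n + 1)) (.ctl 1 (r * n + d)) (.ctl f (r * n + d + 1)) := by
      by_cases h : d + 1 = n
      · exact ⟨2, by omega, by simp, .c12 _ rfl (hdv.2 h)⟩
      · exact ⟨1, by simp, by omega, .c11 _ rfl (fun h' => h (hdv.1 h'))⟩
    obtain ⟨f, hf1, hf2, hc⟩ := hci
    refine ⟨_, f, hf1, hf2, ?_, ?_, ?_, hr.tail (fwd_step hn (by omega) hc hz hen hcd)⟩
    · simp [hl]
    · intro i hi
      obtain ⟨j, hj, rfl⟩ := List.mem_map.1 hi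
      rcases hall j hj with ⟨s, rfl, h1, h2⟩ | ⟨s, rfl, h1⟩
      · by_cases hs : s = r * n + d
        · right; exact ⟨r * n + d, by simp [hs], hdiv⟩
        · left; exact ⟨s, by simp [hs], by omega, by omega⟩
      · right; exact ⟨s, by simp, h1⟩
    · intro s h1 h2
      rw [← hcnt s (by omega) h2, List.count, List.countP_map]
      refine List.countP_congr fun i hi => ?_
      by_cases hi2 : i = .live (r * n + d)
      · subst hi2; simp; omega
      · simp [hi2]

theorem sub_lang {n k : ℕ} (hn : 1 ≤ n) :
    sepLang (n * k) ⊆ (theG n k).lang (theMode k) := by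
  rintro w ⟨i, hi, rfl⟩
  obtain ⟨r, rfl⟩ : ∃ r, i = r + 1 := ⟨i - 1, by omega⟩
  obtain ⟨l, f, -, hf, hl, hall, -, hr⟩ := fin_reach (k := k) hn r n le_rfl
  have := hf rfl
  subst this
  rw [final_ren (r := r) hl] at hr
  · exact hr
  · intro i hi
    rcases hall i hi with ⟨s, -, h1, h2⟩ | h
    · omega
    · exact h

/-- For all n, k ∈ ℕ (positive),
S_{n·k} ∈ L(CD_{n+1}, CF−λ, (t∧=k+1)). -/
theorem stmt7 (n k : ℕ) (hn : 1 ≤ n) (hk : 1 ≤ k) :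
    sepLang (n * k) ∈ CDFam ℕ true (n + 1) (Mode.conj Mode.t (Mode.eq (k + 1))) := by
  refine ⟨theG n k, le_rfl, fun _ => theG_lf n k, ?_⟩
  have h : (theG n k).lang (theMode k) = sepLang (n * k) :=
    Set.Subset.antisymm (lang_sub hn) (sub_lang hn)
  unfold EqL
  rw [h]

end CDHybrid
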